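/- If K is a set of q(q−4) points in PG(2,q), q ≥ 7, such that every line meets K in 0, q−4, q−3, or q−2 points, then q = 7 and the line spectrum is (a_0, a_3, a_4, a_5) = (8, 28, 21, 0). -/

import Mathlib

open Module
open scoped Classical

open Configuration ProjectivePlane

section AbstractPlane

variable {P L : Type*} [Membership P L] [Fintype L]

/-- The number of points of `K` on the line `l`. -/
noncomputable def lineMult (K : Finset P) (l : L) : ℕ := (K.filter fun p => p ∈ l).card

theorem sum_mul_lineMult (K : Finset P) (f : L → ℕ) :
    ∑ l : L, f l * lineMult K l = ∑ k ∈ K, ∑ l : L with k ∈ l, f l := by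
  simp only [lineMult, Finset.card_filter, Finset.mul_sum, Finset.sum_filter, mul_ite, mul_one,
    mul_zero]
  exact Finset.sum_comm

/-- The number of lines meeting `K` in exactly `i` points. -/
noncomputable def spectrumCount (L : Type*) [Membership P L] [Fintype L] (K : Finset P) (i : ℕ) :
    ℕ :=
  (Finset.univ.filter fun l : L => lineMult K l = i).card

theorem sum_comp_lineMult {K : Finset P} {r : ℕ} (hr : 0 < r)
    (hlines : ∀ l : L, lineMult K l ∈ ({0, r, r + 1, r + 2} : Set ℕ)) (g : ℕ → ℕ) :
    ∑ l : L, g (lineMult K l) = spectrumCount L K 0 * g 0 + spectrumCount L K r * g r +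
      spectrumCount L K (r + 1) * g (r + 1) + spectrumCount L K (r + 2) * g (r + 2) := by
  have hmaps : ∀ l ∈ (Finset.univ : Finset L),
      lineMult K l ∈ ({0, r, r + 1, r + 2} : Finset ℕ) := by
    intro l _
    simpa using hlines l
  rw [← Finset.sum_fiberwise_of_maps_to hmaps]
  have h : ∀ i, ∑ l : L with lineMult K l = i, g (lineMult K l) = spectrumCount L K i * g i := by
    intro i
    rw [Finset.sum_congr rfl fun l hl => by rw [(Finset.mem_filter.1 hl).2]]
    simp [spectrumCount]
  simp only [h]
  rw [Finset.sum_insert (by simp; omega), Finset.sum_insert (by simp), Finset.sum_insert (by simp),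
    Finset.sum_singleton]
  ring

variable [ProjectivePlane P L]

theorem card_lines_through_two {p k : P} (h : p ≠ k) :
    (Finset.univ.filter fun l : L => p ∈ l ∧ k ∈ l).card = 1 := by
  rw [Finset.card_eq_one]
  obtain ⟨h1, h2⟩ := HasLines.mkLine_ax (L := L) h
  refine ⟨HasLines.mkLine h, ?_⟩
  ext l
  simp only [Finset.mem_filter, Finset.mem_univ, true_and, Finset.mem_singleton]
  constructor
  · rintro ⟨h3, h4⟩
    exact (Nondegenerate.eq_or_eq h3 h4 h1 h2).resolve_left h
  · rintro rfl
    exact ⟨h1, h2⟩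

variable [Fintype P]

theorem card_lines_through (p : P) :
    (Finset.univ.filter fun l : L => p ∈ l).card = order P L + 1 := by
  rw [← lineCount_eq (L := L) p, lineCount, Nat.card_eq_fintype_card, Fintype.card_subtype]

theorem sum_lineMult_through (K : Finset P) (p : P) :
    ∑ l : L with p ∈ l, lineMult K l = K.card + if p ∈ K then order P L else 0 := by
  have h1 : ∑ l : L with p ∈ l, lineMult K l
      = ∑ k ∈ K, (Finset.univ.filter fun l : L => k ∈ l ∧ p ∈ l).card := by
    have h := sum_mul_lineMult K fun l : L => if p ∈ l then 1 else 0
    simpa only [ite_mul, one_mul, zero_mul, ← Finset.sum_filter, Finset.filter_filter,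
      Finset.sum_const, smul_eq_mul, mul_one] using h
  have h2 : ∀ k ∈ K, (Finset.univ.filter fun l : L => k ∈ l ∧ p ∈ l).card
      = 1 + if p = k then order P L else 0 := by
    intro k _
    split_ifs with h
    · subst h
      simp [card_lines_through, add_comm]
    · exact card_lines_through_two (Ne.symm h)
  rw [h1, Finset.sum_congr rfl h2, Finset.sum_add_distrib, Finset.sum_ite_eq]
  simp

theorem sum_lineMult (K : Finset P) :
    ∑ l : L, lineMult K l = K.card * (order P L + 1) := by
  have h := sum_mul_lineMult (L := L) K fun _ => 1
  simpa [card_lines_through] using h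

theorem sum_lineMult_sq (K : Finset P) :
    ∑ l : L, lineMult K l * lineMult K l = K.card * (K.card + order P L) := by
  rw [sum_mul_lineMult, Finset.sum_congr rfl fun k hk => by
    rw [sum_lineMult_through, if_pos hk]]
  simp

theorem spectrumCount_equations {K : Finset P} {r : ℕ} (hr : 0 < r) (horder : order P L = r + 4)
    (hcard : K.card = (r + 4) * r)
    (hlines : ∀ l : L, lineMult K l ∈ ({0, r, r + 1, r + 2} : Set ℕ)) :
    (spectrumCount L K r : ℤ) + spectrumCount L K (r + 1) + spectrumCount L K (r + 2) =
        (r + 4) ^ 2 + (r + 4) + 1 - spectrumCount L K 0 ∧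
      (spectrumCount L K (r + 1) : ℤ) = r * ((r + 2) * spectrumCount L K 0 - (5 * r + 18)) ∧
      2 * (spectrumCount L K (r + 2) : ℤ) = r * (5 * r + 17 - (r + 1) * spectrumCount L K 0) := by
  have h0 := sum_comp_lineMult hr hlines fun _ => 1
  have h1 := sum_comp_lineMult hr hlines fun i => i
  have h2 := sum_comp_lineMult hr hlines fun i => i * i
  rw [sum_lineMult, hcard, horder] at h1
  rw [sum_lineMult_sq, hcard, horder] at h2
  rw [Finset.sum_const, Finset.card_univ, card_lines P L, horder] at h0
  simp only [smul_eq_mul, mul_one, mul_zero, zero_add] at h0 h1 h2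
  zify at h0 h1 h2
  refine ⟨by linear_combination -h0, ?_, ?_⟩
  · linear_combination h2 - (2 * r + 2) * h1 + r * (r + 2) * h0
  · linear_combination -h2 + (2 * r + 1) * h1 - r * (r + 1) * h0

theorem card_zero_lines_through {K : Finset P} {r : ℕ} (horder : order P L = r + 4)
    (hcard : K.card = (r + 4) * r)
    (hlines : ∀ l : L, lineMult K l ∈ ({0, r, r + 1, r + 2} : Set ℕ))
    {p : P} (hp : p ∉ K) {l : L} (hpl : p ∈ l) (hl : lineMult K l = r + 1) :
    2 ≤ (Finset.univ.filter fun m : L => p ∈ m ∧ lineMult K m = 0).card := by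
  by_contra! hlt
  have hsum := sum_lineMult_through (L := L) K p
  rw [if_neg hp, hcard, add_zero] at hsum
  have hl_mem : l ∈ Finset.univ.filter fun m : L => p ∈ m ∧ lineMult K m ≠ 0 := by
    simp [hpl, hl]
  have hsplit : ∑ m : L with p ∈ m, lineMult K m
      = ∑ m : L with p ∈ m ∧ lineMult K m ≠ 0, lineMult K m := by
    rw [← Finset.filter_filter, Finset.sum_filter_ne_zero]
  have hcount := Finset.card_filter_add_card_filter_not
    (s := Finset.univ.filter fun m : L => p ∈ m) (fun m => lineMult K m = 0)
  rw [Finset.filter_filter, Finset.filter_filter, card_lines_through, horder] at hcount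
  have hbound : (Finset.univ.filter fun m : L => p ∈ m ∧ lineMult K m ≠ 0).card * r
      < ∑ m : L with p ∈ m ∧ lineMult K m ≠ 0, lineMult K m := by
    rw [← smul_eq_mul, ← Finset.sum_const]
    refine Finset.sum_lt_sum (fun m hm => ?_) ⟨l, hl_mem, by omega⟩
    have h1 := (Finset.mem_filter.1 hm).2.2
    have h2 := hlines m
    simp only [Set.mem_insert_iff, Set.mem_singleton_iff] at h2
    omega
  have hge : r + 4 ≤ (Finset.univ.filter fun m : L => p ∈ m ∧ lineMult K m ≠ 0).card := by
    simp only [ne_eq]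
    omega
  have := Nat.mul_le_mul_right r hge
  omega

theorem eight_le_spectrumCount_zero {K : Finset P} {r : ℕ} (hr : 0 < r)
    (horder : order P L = r + 4) (hcard : K.card = (r + 4) * r)
    (hlines : ∀ l : L, lineMult K l ∈ ({0, r, r + 1, r + 2} : Set ℕ))
    {l : L} (hl : lineMult K l = r + 1) : 8 ≤ spectrumCount L K 0 := by
  have hoff : (Finset.univ.filter fun p : P => p ∈ l ∧ p ∉ K).card = 4 := by
    have h1 : (Finset.univ.filter fun p : P => p ∈ l).card = r + 5 := by
      have h := pointCount_eq P l
      rw [pointCount, Nat.card_eq_fintype_card, Fintype.card_subtype, horder] at h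
      exact h
    have h2 := Finset.card_filter_add_card_filter_not
      (s := Finset.univ.filter fun p : P => p ∈ l) (fun p => p ∈ K)
    rw [Finset.filter_filter, Finset.filter_filter, h1] at h2
    have h3 : (Finset.univ.filter fun p : P => p ∈ l ∧ p ∈ K) = K.filter fun p => p ∈ l := by
      ext p
      simp [and_comm]
    rw [h3] at h2
    unfold lineMult at hl
    omega
  have hdisj : ((Finset.univ.filter fun p : P => p ∈ l ∧ p ∉ K : Finset P) : Set P).PairwiseDisjoint
      fun p => Finset.univ.filter fun m : L => p ∈ m ∧ lineMult K m = 0 := by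
    intro p hp p' hp' hne
    rw [Function.onFun, Finset.disjoint_left]
    intro m hm hm'
    simp only [Finset.coe_filter, Finset.mem_univ, true_and, Set.mem_ofPred_eq,
      Finset.mem_filter] at hp hp' hm hm'
    rcases Nondegenerate.eq_or_eq hp.1 hp'.1 hm.1 hm'.1 with h | h
    · exact hne h
    · rw [h, hm.2] at hl
      omega
  calc 8 = ∑ p : P with p ∈ l ∧ p ∉ K, 2 := by rw [Finset.sum_const, hoff]; rfl
    _ ≤ ∑ p : P with p ∈ l ∧ p ∉ K,
        (Finset.univ.filter fun m : L => p ∈ m ∧ lineMult K m = 0).card := by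
      refine Finset.sum_le_sum fun p hp => ?_
      obtain ⟨hpl, hpK⟩ := (Finset.mem_filter.1 hp).2
      exact card_zero_lines_through horder hcard hlines hpK hpl hl
    _ = _ := (Finset.card_biUnion hdisj).symm
    _ ≤ spectrumCount L K 0 := by
      refine Finset.card_le_card fun m hm => ?_
      simp only [Finset.mem_biUnion, Finset.mem_filter, Finset.mem_univ, true_and] at hm ⊢
      obtain ⟨_, _, _, h⟩ := hm
      exact h

theorem spectrum_of_projectivePlane {K : Finset P} {r : ℕ} (hr : 3 ≤ r) (hr6 : r ≠ 6)
    (horder : order P L = r + 4) (hcard : K.card = (r + 4) * r)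
    (hlines : ∀ l : L, lineMult K l ∈ ({0, r, r + 1, r + 2} : Set ℕ)) :
    r = 3 ∧ spectrumCount L K 0 = 8 ∧ spectrumCount L K r = 28 ∧
      spectrumCount L K (r + 1) = 21 ∧ spectrumCount L K (r + 2) = 0 := by
  have hr0 : 0 < r := by omega
  obtain ⟨hx, hy, hz⟩ := spectrumCount_equations hr0 horder hcard hlines
  have hrZ : (0 : ℤ) < r := by exact_mod_cast hr0
  have hupper : ((r : ℤ) + 1) * spectrumCount L K 0 ≤ 5 * r + 17 := by
    have : (0 : ℤ) ≤ r * (5 * r + 17 - (r + 1) * spectrumCount L K 0) := by omega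
    linarith [nonneg_of_mul_nonneg_right this hrZ]
  have hne : spectrumCount L K (r + 1) ≠ 0 := by
    intro h
    rw [h, Nat.cast_zero, eq_comm, mul_eq_zero] at hy
    have h1 : ((r : ℤ) + 2) * (spectrumCount L K 0 - 5) = 8 := by
      rcases hy with hy | hy
      · omega
      · linear_combination hy
    have h2 : 0 < (spectrumCount L K 0 : ℤ) - 5 := by
      by_contra! h
      nlinarith
    have h3 : (spectrumCount L K 0 : ℤ) - 5 < 2 := by nlinarith
    have h4 : (spectrumCount L K 0 : ℤ) - 5 = 1 := by omega
    rw [h4] at h1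
    omega
  obtain ⟨l, hl⟩ := Finset.card_ne_zero.1 hne
  have h8 := eight_le_spectrumCount_zero hr0 horder hcard hlines (Finset.mem_filter.1 hl).2
  have h8Z : (8 : ℤ) ≤ spectrumCount L K 0 := by exact_mod_cast h8
  have hr3 : r = 3 := by
    have : ((r : ℤ) + 1) * 8 ≤ (r + 1) * spectrumCount L K 0 := by gcongr
    omega
  subst hr3
  push_cast at hx hy hz hupper ⊢
  refine ⟨trivial, ?_, ?_, ?_, ?_⟩ <;> omega

end AbstractPlane

section SubmodulePlane

variable (F : Type*) [Field F]

/-- The points of `PG(2, F)`, as one-dimensional subspaces of `F³`. -/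
abbrev PGPoint := {P : Submodule F (Fin 3 → F) // finrank F P = 1}

/-- The lines of `PG(2, F)`, as two-dimensional subspaces of `F³`. -/
abbrev PGLine := {L : Submodule F (Fin 3 → F) // finrank F L = 2}

variable {F}

instance : Membership (PGPoint F) (PGLine F) := ⟨fun l p => p.1 ≤ l.1⟩

theorem PGPoint.mem_iff {p : PGPoint F} {l : PGLine F} : p ∈ l ↔ p.1 ≤ l.1 := Iff.rfl

theorem PGPoint.finrank_sup {p p' : PGPoint F} (h : p ≠ p') : finrank F ↥(p.1 ⊔ p'.1) = 2 := by
  have h1 := Submodule.finrank_sup_add_finrank_inf_eq p.1 p'.1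
  rw [p.2, p'.2] at h1
  have h2 : finrank F ↥(p.1 ⊓ p'.1) ≠ 1 := by
    intro h3
    have e1 := Submodule.eq_of_le_of_finrank_eq (inf_le_left : p.1 ⊓ p'.1 ≤ p.1) (h3.trans p.2.symm)
    have e2 := Submodule.eq_of_le_of_finrank_eq (inf_le_right : p.1 ⊓ p'.1 ≤ p'.1)
      (h3.trans p'.2.symm)
    exact h (Subtype.ext (e1.symm.trans e2))
  have h4 := Submodule.finrank_mono (inf_le_left : p.1 ⊓ p'.1 ≤ p.1)
  rw [p.2] at h4
  omega

theorem PGLine.finrank_inf {l l' : PGLine F} (h : l ≠ l') : finrank F ↥(l.1 ⊓ l'.1) = 1 := by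
  have h1 := Submodule.finrank_sup_add_finrank_inf_eq l.1 l'.1
  rw [l.2, l'.2] at h1
  have h2 : finrank F ↥(l.1 ⊓ l'.1) ≠ 2 := by
    intro h3
    have e1 := Submodule.eq_of_le_of_finrank_eq (inf_le_left : l.1 ⊓ l'.1 ≤ l.1) (h3.trans l.2.symm)
    have e2 := Submodule.eq_of_le_of_finrank_eq (inf_le_right : l.1 ⊓ l'.1 ≤ l'.1)
      (h3.trans l'.2.symm)
    exact h (Subtype.ext (e1.symm.trans e2))
  have h4 := Submodule.finrank_mono (inf_le_left : l.1 ⊓ l'.1 ≤ l.1)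
  rw [l.2] at h4
  have h5 := Submodule.finrank_le (l.1 ⊔ l'.1)
  rw [finrank_fin_fun] at h5
  omega

/-- The point spanned by a nonzero vector. -/
def PGPoint.span (v : Fin 3 → F) (hv : v ≠ 0) : PGPoint F :=
  ⟨Submodule.span F {v}, finrank_span_singleton hv⟩

/-- The line cut out by a nonzero linear form. -/
def PGLine.ker (f : Module.Dual F (Fin 3 → F)) (hf : f ≠ 0) : PGLine F :=
  ⟨LinearMap.ker f, by
    have h := Module.Dual.finrank_ker_add_one_of_ne_zero hf
    rw [finrank_fin_fun] at h
    omega⟩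

theorem PGPoint.span_mem_ker {v : Fin 3 → F} (hv : v ≠ 0) {f : Module.Dual F (Fin 3 → F)} (hf : f ≠ 0) :
    PGPoint.span v hv ∈ PGLine.ker f hf ↔ f v = 0 := by
  rw [PGPoint.mem_iff, PGPoint.span, PGLine.ker, Submodule.span_singleton_le_iff_mem,
    LinearMap.mem_ker]

noncomputable instance : ProjectivePlane (PGPoint F) (PGLine F) where
  exists_point l := by
    obtain ⟨C, hC⟩ := l.1.exists_isCompl
    have h := Submodule.finrank_add_eq_of_isCompl hC
    rw [l.2, finrank_fin_fun] at h
    have hC1 : finrank F C = 1 := by omega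
    refine ⟨⟨C, hC1⟩, fun hmem => ?_⟩
    rw [hC.disjoint.eq_bot_of_ge hmem, finrank_bot] at hC1
    omega
  exists_line p := by
    obtain ⟨C, hC⟩ := p.1.exists_isCompl
    have h := Submodule.finrank_add_eq_of_isCompl hC
    rw [p.2, finrank_fin_fun] at h
    refine ⟨⟨C, by omega⟩, fun hmem => ?_⟩
    have hp := p.2
    rw [hC.disjoint.eq_bot_of_le hmem, finrank_bot] at hp
    omega
  eq_or_eq {p p' l l'} h1 h2 h3 h4 := by
    by_contra! h
    have h5 := PGPoint.finrank_sup h.1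
    have h6 := PGLine.finrank_inf h.2
    have h7 := Submodule.finrank_mono (sup_le (le_inf h1 h3) (le_inf h2 h4))
    omega
  mkPoint {l l'} h := ⟨l.1 ⊓ l'.1, PGLine.finrank_inf h⟩
  mkPoint_ax _ := ⟨inf_le_left, inf_le_right⟩
  mkLine {p p'} h := ⟨p.1 ⊔ p'.1, PGPoint.finrank_sup h⟩
  mkLine_ax _ := ⟨le_sup_left, le_sup_right⟩
  exists_config := by
    let x : Fin 3 → Module.Dual F (Fin 3 → F) := LinearMap.proj
    have hv : ∀ i, (Pi.single i 1 : Fin 3 → F) ≠ 0 := fun i => by simp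
    have hf0 : x 0 ≠ 0 := fun h => by
      simpa [x] using LinearMap.congr_fun h (Pi.single 0 1)
    have hf1 : x 0 + x 2 ≠ 0 := fun h => by
      simpa [x] using LinearMap.congr_fun h (Pi.single 0 1)
    have hf2 : x 1 + x 2 ≠ 0 := fun h => by
      simpa [x] using LinearMap.congr_fun h (Pi.single 1 1)
    refine ⟨PGPoint.span _ (hv 0), PGPoint.span _ (hv 1), PGPoint.span _ (hv 2),
      PGLine.ker _ hf2, PGLine.ker _ hf0, PGLine.ker _ hf1, ?_⟩
    simp [PGPoint.span_mem_ker, x]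

theorem order_PG [Fintype F] : order (PGPoint F) (PGLine F) = Fintype.card F := by
  have h1 := card_points (PGPoint F) (PGLine F)
  have h2 := Projectivization.card_of_finrank F (Fin 3 → F) (finrank_fin_fun F)
  rw [Nat.card_congr (Projectivization.equivSubmodule F (Fin 3 → F)), Nat.card_eq_fintype_card,
    h1, Nat.card_eq_fintype_card] at h2
  simp only [Finset.sum_range_succ, Finset.sum_range_zero, pow_zero, pow_one] at h2
  nlinarith [h2]

end SubmodulePlane

/-- if `K` is a set of `q(q-4)` points in `PG(2,q)`, `q ≥ 7`, all
of whose line multiplicities lie in `{0, q-4, q-3, q-2}`, then `q = 7` and the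
line spectrum is `(a 0, a (q-4), a (q-3), a (q-2)) = (8, 28, 21, 0)`, where
`a i` counts the lines meeting `K` in exactly `i` points. -/
theorem stmt15 (q : ℕ) (hq : 7 ≤ q)
    (F : Type) [Field F] [Fintype F] (hF : Fintype.card F = q)
    (K : Finset (Submodule F (Fin 3 → F))) (hpts : ∀ P ∈ K, finrank F P = 1)
    (hcard : K.card = q * (q - 4))
    (hlines : ∀ L : Submodule F (Fin 3 → F), finrank F L = 2 →
      (K.filter fun P => P ≤ L).card ∈ ({0, q - 4, q - 3, q - 2} : Set ℕ))
    (a : ℕ → ℕ)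
    (ha : ∀ i, a i = Nat.card {L : Submodule F (Fin 3 → F) //
        finrank F L = 2 ∧ (K.filter fun P => P ≤ L).card = i}) :
    q = 7 ∧ a 0 = 8 ∧ a (q - 4) = 28 ∧ a (q - 3) = 21 ∧ a (q - 2) = 0 := by
  have hq10 : q ≠ 10 := by
    rintro rfl
    have h := FiniteField.isPrimePow_card F
    rw [hF, isPrimePow_nat_iff_bounded] at h
    revert h
    decide
  obtain ⟨r, rfl⟩ : ∃ r, q = r + 4 := ⟨q - 4, by omega⟩
  have e4 : r + 4 - 4 = r := by omega
  have e3 : r + 4 - 3 = r + 1 := by omega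
  have e2 : r + 4 - 2 = r + 2 := by omega
  rw [e4] at hcard
  rw [e4, e3, e2] at hlines ⊢
  let K' : Finset (PGPoint F) := K.subtype fun P : Submodule F (Fin 3 → F) => finrank F P = 1
  have hmult : ∀ l : PGLine F, lineMult K' l = (K.filter fun P => P ≤ l.1).card := by
    intro l
    rw [lineMult, ← Finset.card_map (Function.Embedding.subtype _)]
    congr 1
    ext P
    simp only [Finset.mem_map, Finset.mem_filter, Finset.mem_subtype, K', PGPoint.mem_iff,
      Function.Embedding.coe_subtype, Subtype.exists, exists_and_right, exists_eq_right]
    exact ⟨fun ⟨⟨_, h⟩, h'⟩ => ⟨h, h'⟩, fun h => ⟨⟨hpts P h.1, h.1⟩, h.2⟩⟩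
  have hcard' : K'.card = (r + 4) * r := by
    rw [← hcard, Finset.card_subtype, Finset.filter_true_of_mem hpts]
  have hcount : ∀ i, a i = spectrumCount (PGLine F) K' i := by
    intro i
    rw [ha, spectrumCount, ← Fintype.card_subtype, ← Nat.card_eq_fintype_card]
    simp only [hmult]
    exact Nat.card_congr (Equiv.subtypeSubtypeEquivSubtypeInter _
      fun L : Submodule F (Fin 3 → F) => (K.filter fun P => P ≤ L).card = i).symm
  obtain ⟨h, h'⟩ := spectrum_of_projectivePlane (K := K') (L := PGLine F) (by omega) (by omega)
    (order_PG.trans hF) hcard' fun l => by rw [hmult]; exact hlines l.1 l.2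
  simp only [hcount]
  exact ⟨by omega, h'⟩
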